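/- arXiv:1312.6560 — 4 statements merged into one kernel-verified Lean document; each statement's English description precedes it below -/
import Mathlib

section
/- Let A be an abelian category, K, Y objects, and L a finitely generated Γ(K)-submodule of Ext¹(Y, K). Then there exists a short exact sequence ξ : 0 → K₁ → X → Y → 0 with K₁ ∈ add K and Im c(ξ, K) = L. -/
set_option linter.unusedSectionVars false

open CategoryTheory Abelian Limits

universe w v u

attribute [local instance] CategoryTheory.Abelian.hasFiniteBiproducts

variable {A : Type u} [Category.{v} A] [Abelian A]

/-- `M` belongs to `add K`: it is a direct summand of a finite direct sum of copies of `K`. -/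
def InAdd (K M : A) : Prop :=
  ∃ (n : ℕ) (s : M ⟶ ⨁ (fun _ : Fin n => K)) (r : (⨁ fun _ : Fin n => K) ⟶ M),
    s ≫ r = 𝟙 M

/-- `α` factors through `α'`. -/
def Factors {X X' Y : A} (α : X ⟶ Y) (α' : X' ⟶ Y) : Prop :=
  ∃ v : X ⟶ X', v ≫ α' = α

/-- `α` and `α'` are right equivalent. -/
def RightEquiv {X X' Y : A} (α : X ⟶ Y) (α' : X' ⟶ Y) : Prop :=
  Factors α α' ∧ Factors α' α

/-- A morphism is right minimal. -/
def RightMinimal {X Y : A} (α : X ⟶ Y) : Prop :=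
  ∀ v : X ⟶ X, v ≫ α = α → IsIso v

/-- A short exact sequence `0 → K → X → Y → 0`. -/
structure SES (K Y : A) where
  X : A
  i : K ⟶ X
  p : X ⟶ Y
  zero : i ≫ p = 0
  shortExact : (ShortComplex.mk i p zero).ShortExact

variable [HasExt.{w} A]

lemma Ext.mk₀_add' {X Y : A} (f g : X ⟶ Y) :
    Ext.mk₀ (f + g) = Ext.mk₀ f + Ext.mk₀ g := by
  letI := HasDerivedCategory.standard A
  apply Ext.ext
  simp [Ext.add_hom, ShiftedHom.mk₀, Functor.map_add]

/-- The class `[ξ] ∈ Ext¹(Y, K)` of a short exact sequence `ξ`. -/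
noncomputable def SES.cls {K Y : A} (E : SES K Y) : Ext Y K 1 :=
  E.shortExact.extClass

/-- The class `[u.ξ]` of the pushout of `ξ` along `u`. -/
noncomputable def SES.push {K Y Z : A} (E : SES K Y) (u : K ⟶ Z) : Ext Y Z 1 :=
  E.cls.comp (Ext.mk₀ u) (add_zero 1)

noncomputable instance extSMulEnd (Y K : A) : SMul (End K) (Ext Y K 1) :=
  ⟨fun g e => e.comp (Ext.mk₀ g) (add_zero 1)⟩

lemma extSmul_def {Y K : A} (g : End K) (e : Ext Y K 1) :
    g • e = e.comp (Ext.mk₀ g) (add_zero 1) := rfl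

/-- `Ext¹(Y, K)` as a left module over `Γ(K) = End K`, via pushout. -/
noncomputable instance extModuleEnd (Y K : A) : Module (End K) (Ext Y K 1) where
  one_smul e := by rw [extSmul_def]; exact Ext.comp_mk₀_id e
  mul_smul g h e := by
    rw [extSmul_def, extSmul_def, extSmul_def,
      Ext.comp_assoc_of_third_deg_zero, Ext.mk₀_comp_mk₀]
    rfl
  smul_add g e f := by
    rw [extSmul_def, extSmul_def, extSmul_def]; exact Ext.add_comp e f _ _
  add_smul g h e := by
    rw [extSmul_def, extSmul_def, extSmul_def, Ext.mk₀_add', Ext.comp_add]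
  zero_smul e := by rw [extSmul_def]; rw [Ext.mk₀_zero, Ext.comp_zero]
  smul_zero g := by rw [extSmul_def]; exact Ext.zero_comp _ _ _ _ _

/-- The connecting map `c(ξ, K) : Hom(K₁, K) → Ext¹(Y, K)`, `u ↦ [u.ξ]`,
as a morphism of left `Γ(K) = End K`-modules. -/
noncomputable def SES.conn {K₁ Y : A} (E : SES K₁ Y) (K : A) :
    (K₁ ⟶ K) →ₗ[End K] Ext Y K 1 where
  toFun u := E.push u
  map_add' u v := by
    dsimp [SES.push]
    rw [Ext.mk₀_add', Ext.comp_add]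
  map_smul' g u := by
    dsimp [SES.push]
    rw [End.smul_right, extSmul_def, Ext.comp_assoc_of_third_deg_zero,
      Ext.mk₀_comp_mk₀]

/-- Right minimality for a morphism of modules. -/
def ModRightMinimal {R : Type*} [Ring R] {M N : Type*} [AddCommGroup M] [AddCommGroup N]
    [Module R M] [Module R N] (c : M →ₗ[R] N) : Prop :=
  ∀ g : M →ₗ[R] M, c.comp g = c → Function.Bijective g

universe w'

/-- The `R`-module `M` admits a projective cover. -/
def HasProjCover (R : Type*) [Ring R] (M : Type w') [AddCommGroup M] [Module R M] : Prop :=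
  ∃ (P : Type w') (_ : AddCommGroup P) (_ : Module R P) (f : P →ₗ[R] M),
    Module.Projective R P ∧ Function.Surjective f ∧ ModRightMinimal f

/-- `ξ` is a universal `L`-extension of `Y` by `K`. -/
def IsUniversalExt (K : A) {K₁ Y : A} (E : SES K₁ Y) (L : Submodule (End K) (Ext Y K 1)) :
    Prop :=
  InAdd K K₁ ∧ LinearMap.range (E.conn K) = L ∧ ModRightMinimal (E.conn K)

lemma InAdd.self (K : A) : InAdd K K := by
  refine ⟨1, biproduct.ι (fun _ : Fin 1 => K) (0 : Fin 1), biproduct.π (fun _ : Fin 1 => K) 0, ?_⟩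
  simp

open Pretriangulated Triangulated DerivedCategory in
/-- In the derived category, an extension of `singleFunctor Y` by `singleFunctor Z` is given by
a short exact sequence. -/
lemma exists_singleδ_eq {C : Type u} [Category.{v} C] [Abelian C] [HasDerivedCategory.{w'} C]
    {Y Z : C}
    (h : (singleFunctor C 0).obj Y ⟶ ((singleFunctor C 0).obj Z)⟦(1 : ℤ)⟧) :
    ∃ E : SES Z Y, E.shortExact.singleδ = h := by
  obtain ⟨M, f, g, hT⟩ := distinguished_cocone_triangle₂ h
  have : M.IsLE 0 := DerivedCategory.TStructure.t.isLE₂ _ hT 0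
    (inferInstanceAs (((singleFunctor C 0).obj Z).IsLE 0))
    (inferInstanceAs (((singleFunctor C 0).obj Y).IsLE 0))
  have : M.IsGE 0 := DerivedCategory.TStructure.t.isGE₂ _ hT 0
    (inferInstanceAs (((singleFunctor C 0).obj Z).IsGE 0))
    (inferInstanceAs (((singleFunctor C 0).obj Y).IsGE 0))
  obtain ⟨X, ⟨e⟩⟩ := exists_iso_singleFunctor_obj_of_isGE_of_isLE M 0
  obtain ⟨i, hi⟩ := (singleFunctor C 0).map_surjective (f ≫ e.hom)
  obtain ⟨p, hp⟩ := (singleFunctor C 0).map_surjective (e.inv ≫ g)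
  have hT' : Triangle.mk ((singleFunctor C 0).map i) ((singleFunctor C 0).map p) h ∈
      distTriang (DerivedCategory C) := by
    refine isomorphic_distinguished _ hT _
      (Triangle.isoMk _ _ (Iso.refl _) e.symm (Iso.refl _) ?_ ?_ ?_)
    · change (singleFunctor C 0).map i ≫ e.inv = 𝟙 ((singleFunctor C 0).obj Z) ≫ f
      simp [hi]
    · change (singleFunctor C 0).map p ≫ 𝟙 ((singleFunctor C 0).obj Y) = e.inv ≫ g
      simp [hp]
    · change h ≫ (𝟙 ((singleFunctor C 0).obj Z))⟦(1 : ℤ)⟧' =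
        𝟙 ((singleFunctor C 0).obj Y) ≫ h
      simp
  have hom_eq_zero : ∀ ⦃V W : C⦄ ⦃n : ℤ⦄
      (u : (singleFunctor C 0).obj V ⟶ ((singleFunctor C 0).obj W)⟦n⟧), n < 0 → u = 0 := by
    intro V W n u hn
    have := DerivedCategory.TStructure.t.isGE_shift ((singleFunctor C 0).obj W) 0 n (-n)
    exact DerivedCategory.TStructure.t.zero u 0 (-n)
  have zero : i ≫ p = 0 := (singleFunctor C 0).map_injective <| by
    rw [Functor.map_comp, Functor.map_zero]
    exact comp_distTriang_mor_zero₁₂ _ hT'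
  have hker : IsLimit (KernelFork.ofι i zero) :=
    AbelianSubcategory.isLimitKernelForkOfDistTriang hom_eq_zero i p h hT'
  have hcoker : IsColimit (CokernelCofork.ofπ p zero) :=
    AbelianSubcategory.isColimitCokernelCoforkOfDistTriang hom_eq_zero i p h hT'
  have mono_i : Mono i := mono_of_isLimit_fork hker
  have epi_p : Epi p := epi_of_isColimit_cofork hcoker
  have hS : (ShortComplex.mk i p zero).ShortExact :=
    { exact := ShortComplex.exact_of_f_is_kernel _ hker }
  refine ⟨⟨X, i, p, zero, hS⟩, ?_⟩
  obtain ⟨c, hc₂, hc₃⟩ := complete_distinguished_triangle_morphism _ _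
    hS.singleTriangle_distinguished hT' (𝟙 ((singleFunctor C 0).obj Z))
    (𝟙 ((singleFunctor C 0).obj X)) ((Category.comp_id _).trans (Category.id_comp _).symm)
  obtain ⟨c, rfl⟩ := (singleFunctor C 0).map_surjective c
  change (singleFunctor C 0).map p ≫ (singleFunctor C 0).map c =
    𝟙 ((singleFunctor C 0).obj X) ≫ (singleFunctor C 0).map p at hc₂
  change hS.singleδ ≫ (𝟙 ((singleFunctor C 0).obj Z))⟦(1 : ℤ)⟧' =
    (singleFunctor C 0).map c ≫ h at hc₃
  obtain rfl : c = 𝟙 Y := by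
    rw [← cancel_epi p]
    exact (singleFunctor C 0).map_injective (by simpa using hc₂)
  simpa using hc₃

/-- Every class in `Ext¹(Y, Z)` is the class of a short exact sequence. -/
lemma SES.cls_surjective {Y Z : A} :
    Function.Surjective (SES.cls : SES Z Y → Ext.{w} Y Z 1) := by
  have := HasDerivedCategory.standard A
  intro e
  obtain ⟨E, hE⟩ := exists_singleδ_eq (Ext.hom.{_, w} e)
  exact ⟨E, Ext.ext ((ShortComplex.ShortExact.extClass_hom _).trans hE)⟩

lemma InAdd.biproduct (K : A) (n : ℕ) : InAdd K (⨁ fun _ : Fin n => K) :=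
  ⟨n, 𝟙 _, 𝟙 _, Category.id_comp _⟩

/-- If the components of the class of `E` are the `e j`, then the image of the connecting map
is generated by the `e j`. -/
lemma SES.range_conn_biproduct {K Y : A} {n : ℕ} (e : Fin n → Ext.{w} Y K 1)
    (E : SES (⨁ fun _ : Fin n => K) Y)
    (hE : E.cls = (Ext.addEquivBiproduct Y (biproduct.isBilimit fun _ : Fin n => K) 1).symm e) :
    LinearMap.range (E.conn K) = Submodule.span (End K) (Set.range e) := by
  have hcomp (j : Fin n) :
      E.cls.comp (Ext.mk₀ (biproduct.π (fun _ : Fin n => K) j)) (add_zero 1) = e j :=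
    congrFun ((Equiv.eq_symm_apply _).1 hE) j
  have hsum : E.cls = ∑ j, (e j).comp (Ext.mk₀ (biproduct.ι (fun _ : Fin n => K) j))
      (add_zero 1) := hE
  apply le_antisymm
  · rintro _ ⟨u, rfl⟩
    have hu : E.conn K u =
        ∑ j, (show End K from biproduct.ι (fun _ : Fin n => K) j ≫ u) • e j := by
      change E.cls.comp (Ext.mk₀ u) (add_zero 1) = _
      rw [hsum, Ext.sum_comp]
      refine Finset.sum_congr rfl fun j _ => ?_
      rw [Ext.comp_assoc_of_third_deg_zero, Ext.mk₀_comp_mk₀, extSmul_def]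
    rw [hu]
    exact Submodule.sum_mem _ fun j _ =>
      Submodule.smul_mem _ _ (Submodule.subset_span ⟨j, rfl⟩)
  · rw [Submodule.span_le]
    rintro _ ⟨j, rfl⟩
    exact ⟨biproduct.π _ j, hcomp j⟩

/-- existence of semi-universal `L`-extensions. -/
theorem stmt6 (K Y : A) (L : Submodule (End K) (Ext Y K 1)) (hL : L.FG) :
    ∃ (K₁ : A) (E : SES K₁ Y), InAdd K K₁ ∧ LinearMap.range (E.conn K) = L := by
  obtain ⟨n, e, rfl⟩ := Submodule.fg_iff_exists_fin_generating_family.1 hL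
  obtain ⟨E, hE⟩ := SES.cls_surjective
    ((Ext.addEquivBiproduct Y (biproduct.isBilimit fun _ : Fin n => K) 1).symm e)
  exact ⟨_, E, InAdd.biproduct K n, SES.range_conn_biproduct e E hE⟩
end

section
/- Let A be an abelian category and ξ : 0 → K → X →^{α} Y → 0 a short exact sequence. Then α is right minimal if and only if every endomorphism u : K → K satisfying [ξ] = [u.ξ] in Ext¹(Y, K) is an automorphism. -/
set_option linter.unusedSectionVars false

open CategoryTheory Abelian Limits

universe w v u

attribute [local instance] CategoryTheory.Abelian.hasFiniteBiproducts

variable {A : Type u} [Category.{v} A] [Abelian A]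

variable [HasExt.{w} A]

universe w'

namespace SES

/-- An endomorphism `u` of `K` compatible with an automorphism `v` of the middle term over `Y`
is an automorphism. -/
lemma isIso_of_isIso_middle {K Y : A} (E : SES K Y) (u : K ⟶ K) (v : E.X ⟶ E.X)
    (hi : E.i ≫ v = u ≫ E.i) (hp : v ≫ E.p = E.p) [IsIso v] : IsIso u := by
  have := E.shortExact.mono_f
  have hinv : inv v ≫ E.p = E.p := by rw [IsIso.inv_comp_eq, hp]
  have hzero : (E.i ≫ inv v) ≫ E.p = 0 := by rw [Category.assoc, hinv, E.zero]
  let w : K ⟶ K := E.shortExact.exact.lift (E.i ≫ inv v) hzero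
  have hw : w ≫ E.i = E.i ≫ inv v := E.shortExact.exact.lift_f _ hzero
  have : Mono E.i := E.shortExact.mono_f
  refine ⟨w, ?_, ?_⟩
  · rw [← cancel_mono E.i, Category.assoc, hw, ← Category.assoc, ← hi]
    simp
  · rw [← cancel_mono E.i, Category.assoc, ← hi, ← Category.assoc, hw]
    simp

/-- An endomorphism of the middle term over `Y` inducing an automorphism `u` of `K`
is an automorphism. -/
lemma isIso_middle_of_isIso {K Y : A} (E : SES K Y) (u : K ⟶ K) (v : E.X ⟶ E.X)
    (hi : E.i ≫ v = u ≫ E.i) (hp : v ≫ E.p = E.p) [IsIso u] : IsIso v := by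
  let S := ShortComplex.mk E.i E.p E.zero
  let φ : S ⟶ S :=
    { τ₁ := u, τ₂ := v, τ₃ := 𝟙 Y, comm₁₂ := hi.symm
      comm₂₃ := hp.trans (Category.comp_id _).symm }
  have : IsIso φ.τ₁ := ‹IsIso u›
  have : IsIso φ.τ₃ := inferInstanceAs (IsIso (𝟙 Y))
  exact ShortComplex.isIso₂_of_shortExact_of_isIso₁₃ φ E.shortExact E.shortExact

/-- A morphism of extensions which is the identity on `Y` exhibits the target class
as the pushout of the source class. -/
lemma cls_eq_push {K Y : A} (E : SES K Y) (u : K ⟶ K) (v : E.X ⟶ E.X)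
    (hi : E.i ≫ v = u ≫ E.i) (hp : v ≫ E.p = E.p) : E.cls = E.push u := by
  let S := ShortComplex.mk E.i E.p E.zero
  let φ : S ⟶ S :=
    { τ₁ := u, τ₂ := v, τ₃ := 𝟙 Y, comm₁₂ := hi.symm
      comm₂₃ := hp.trans (Category.comp_id _).symm }
  have h := ShortComplex.ShortExact.extClass_naturality E.shortExact E.shortExact φ
  exact (h.trans (Ext.mk₀_id_comp _)).symm

/-- If the pushout of `ξ` along `d` splits, then `d` extends along the inclusion. -/
lemma exists_extension_of_push_eq_zero {K Y Z : A} (E : SES K Y) (d : K ⟶ Z)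
    (h : E.push d = 0) : ∃ g : E.X ⟶ Z, E.i ≫ g = d := by
  obtain ⟨x, hx⟩ := Ext.contravariant_sequence_exact₁ E.shortExact Z (Ext.mk₀ d) (add_zero 1) h
  obtain ⟨g, rfl⟩ := (Ext.mk₀_bijective E.X Z).2 x
  refine ⟨g, (Ext.mk₀_bijective K Z).1 ?_⟩
  exact (Ext.mk₀_comp_mk₀ E.i g).symm.trans hx

end SES

/-- `α` is right minimal iff every `u : K ⟶ K` with `[ξ] = [u.ξ]`
is an automorphism. -/
theorem stmt7 {K Y : A} (E : SES K Y) :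
    RightMinimal E.p ↔ ∀ u : K ⟶ K, E.cls = E.push u → IsIso u := by
  constructor
  · intro hmin u hu
    have hpush : E.push (u - 𝟙 K) = 0 := by
      have hid : E.conn K (𝟙 K) = E.cls := Ext.comp_mk₀_id _
      have hu' : E.conn K u = E.cls := hu.symm
      have h : E.conn K (u - 𝟙 K) = 0 := by rw [map_sub, hu', hid, sub_self]
      exact h
    obtain ⟨g, hg⟩ := E.exists_extension_of_push_eq_zero _ hpush
    have hp : (𝟙 E.X + g ≫ E.i) ≫ E.p = E.p := by simp [E.zero]
    have hi : E.i ≫ (𝟙 E.X + g ≫ E.i) = u ≫ E.i := by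
      rw [Preadditive.comp_add, ← Category.assoc, hg]
      simp
    have := hmin _ hp
    exact E.isIso_of_isIso_middle u _ hi hp
  · intro hu v hp
    have := E.shortExact.mono_f
    have hzero : (E.i ≫ v) ≫ E.p = 0 := by rw [Category.assoc, hp, E.zero]
    let u : K ⟶ K := E.shortExact.exact.lift (E.i ≫ v) hzero
    have hi : E.i ≫ v = u ≫ E.i := (E.shortExact.exact.lift_f _ hzero).symm
    have := hu u (E.cls_eq_push u v hi hp)
    exact E.isIso_middle_of_isIso u v hi hp
end

section
/- Let A be an abelian category, α : X → Y an epimorphism with kernel K₁ ∈ add K, and ξ_α the corresponding short exact sequence. Then α is right equivalent to a right minimal morphism if and only if the Γ(K)-module Im c(ξ_α, K) admits a projective cover. -/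
set_option linter.unusedSectionVars false

open CategoryTheory Abelian Limits

universe w v u

attribute [local instance] CategoryTheory.Abelian.hasFiniteBiproducts

variable {A : Type u} [Category.{v} A] [Abelian A]

variable [HasExt.{w} A]

universe w'

lemma InAdd.of_retract {K M N : A} (h : InAdd K M) (a : N ⟶ M) (b : M ⟶ N)
    (hab : a ≫ b = 𝟙 N) : InAdd K N := by
  obtain ⟨n, s, r, hsr⟩ := h
  exact ⟨n, a ≫ s, r ≫ b, by rw [Category.assoc, reassoc_of% hsr, hab]⟩

lemma InAdd.exists_sum {K M : A} (h : InAdd K M) :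
    ∃ (n : ℕ) (x : Fin n → (M ⟶ K)) (y : Fin n → (K ⟶ M)), ∑ i, x i ≫ y i = 𝟙 M := by
  obtain ⟨n, s, r, hsr⟩ := h
  refine ⟨n, fun i => s ≫ biproduct.π (fun _ : Fin n => K) i, fun i => biproduct.ι (fun _ : Fin n => K) i ≫ r, ?_⟩
  calc _ = s ≫ (∑ i : Fin n, biproduct.π (fun _ => K) i ≫
        biproduct.ι (fun _ => K) i) ≫ r := by
        simp only [Preadditive.sum_comp, Preadditive.comp_sum, Category.assoc]
    _ = 𝟙 M := by rw [biproduct.total, Category.id_comp, hsr]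

/-- Every `End K`-linear map `Hom(M, K) → Hom(N, K)` with `M ∈ add K` is a precomposition. -/
lemma InAdd.exists_precomp {K M N : A} (h : InAdd K M) (φ : (M ⟶ K) →ₗ[End K] (N ⟶ K)) :
    ∃ t : N ⟶ M, ∀ w, φ w = t ≫ w := by
  obtain ⟨n, x, y, hxy⟩ := h.exists_sum
  refine ⟨∑ i, φ (x i) ≫ y i, fun w => ?_⟩
  have hw : w = ∑ i, (show End K from y i ≫ w) • x i := by
    change w = ∑ i, x i ≫ y i ≫ w
    conv_lhs => rw [← Category.id_comp w, ← hxy, Preadditive.sum_comp]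
    simp only [Category.assoc]
  conv_lhs => rw [hw, map_sum]
  simp only [map_smul]
  simp only [End.smul_right, Preadditive.sum_comp, Category.assoc]

lemma InAdd.hom_ext {K M N : A} (h : InAdd K M) {f g : N ⟶ M}
    (hfg : ∀ w : M ⟶ K, f ≫ w = g ≫ w) : f = g := by
  obtain ⟨n, x, y, hxy⟩ := h.exists_sum
  rw [← Category.comp_id f, ← Category.comp_id g, ← hxy]
  simp only [Preadditive.comp_sum, ← Category.assoc, hfg]

lemma InAdd.ext_ext {K M Y : A} (h : InAdd K M) {e f : Ext Y M 1}
    (hef : ∀ w : M ⟶ K, e.comp (Ext.mk₀ w) (add_zero 1) = f.comp (Ext.mk₀ w) (add_zero 1)) :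
    e = f := by
  obtain ⟨n, x, y, hxy⟩ := h.exists_sum
  have key : ∀ e : Ext Y M 1, e =
      ∑ i, (e.comp (Ext.mk₀ (x i)) (add_zero 1)).comp (Ext.mk₀ (y i)) (add_zero 1) := by
    intro e
    simp only [Ext.comp_assoc_of_third_deg_zero, Ext.mk₀_comp_mk₀]
    rw [← Ext.comp_sum, ← Ext.mk₀_sum, hxy, Ext.comp_mk₀_id]
  rw [key e, key f]
  simp only [hef]

lemma InAdd.projective_hom {K M : A} (h : InAdd K M) : Module.Projective (End K) (M ⟶ K) := by
  obtain ⟨n, x, y, hxy⟩ := h.exists_sum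
  let a : (M ⟶ K) →ₗ[End K] (Fin n → End K) :=
    { toFun := fun w i => y i ≫ w
      map_add' := fun u v => by ext i; exact Preadditive.comp_add _ _ _ _ u v
      map_smul' := fun g u => by
        ext i
        simp [End.smul_right, End.mul_def] }
  let b : (Fin n → End K) →ₗ[End K] (M ⟶ K) :=
    { toFun := fun c => ∑ i, c i • x i
      map_add' := fun u v => by simp [add_smul, Finset.sum_add_distrib]
      map_smul' := fun g u => by
        rw [RingHom.id_apply, Finset.smul_sum]
        exact Finset.sum_congr rfl fun i _ => mul_smul g (u i) (x i) }
  refine Module.Projective.of_split a b ?_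
  ext w
  change ∑ i, x i ≫ y i ≫ w = w
  simp only [← Category.assoc]
  rw [← Preadditive.sum_comp, hxy, Category.id_comp]

/-- Precomposition as an `End K`-linear map. -/
def precompEnd (K : A) {M N : A} (t : N ⟶ M) : (M ⟶ K) →ₗ[End K] (N ⟶ K) where
  toFun w := t ≫ w
  map_add' u v := Preadditive.comp_add _ _ _ _ u v
  map_smul' g u := by simp [End.smul_right]

@[simp]
lemma precompEnd_apply (K : A) {M N : A} (t : N ⟶ M) (w : M ⟶ K) :
    precompEnd K t w = t ≫ w := rfl

lemma InAdd.isIso_of_bijective_precompEnd {K M N : A} (hM : InAdd K M) (hN : InAdd K N)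
    (t : N ⟶ M) (ht : Function.Bijective (precompEnd K t)) : IsIso t := by
  let e := LinearEquiv.ofBijective (precompEnd K t) ht
  obtain ⟨s, hs⟩ := hN.exists_precomp e.symm.toLinearMap
  have h₁ : ∀ w : N ⟶ K, t ≫ s ≫ w = w := fun w => by
    rw [← hs]; exact e.apply_symm_apply w
  have h₂ : ∀ w : M ⟶ K, s ≫ t ≫ w = w := fun w => by
    rw [← precompEnd_apply K t w, ← hs]; exact e.symm_apply_apply w
  refine ⟨s, hN.hom_ext fun w => ?_, hM.hom_ext fun w => ?_⟩
  · simp [h₁]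
  · simp [h₂]

namespace SES

lemma push_comp {K₁ Y Z W : A} (E : SES K₁ Y) (u : K₁ ⟶ Z) (v : Z ⟶ W) :
    E.push (u ≫ v) = (E.push u).comp (Ext.mk₀ v) (add_zero 1) := by
  rw [push, push, Ext.comp_assoc_of_third_deg_zero, Ext.mk₀_comp_mk₀]

lemma push_comp_of_push_eq {K₁ K₂ Y Z : A} {E : SES K₁ Y} {F : SES K₂ Y} {t : K₁ ⟶ K₂}
    (h : E.push t = F.cls) (w : K₂ ⟶ Z) : E.push (t ≫ w) = F.push w := by
  rw [push_comp, h, push]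

lemma exists_kernel_map {K₁ K₂ Y : A} (E : SES K₁ Y) (F : SES K₂ Y) (v : E.X ⟶ F.X)
    (hv : v ≫ F.p = E.p) : ∃ t : K₁ ⟶ K₂, t ≫ F.i = E.i ≫ v := by
  have := F.shortExact.mono_f
  exact ⟨F.shortExact.exact.lift (E.i ≫ v) (by simp [hv, E.zero]),
    F.shortExact.exact.lift_f _ _⟩

lemma push_eq_cls {K₁ K₂ Y : A} (E : SES K₁ Y) (F : SES K₂ Y) (v : E.X ⟶ F.X)
    (hv : v ≫ F.p = E.p) (t : K₁ ⟶ K₂) (ht : t ≫ F.i = E.i ≫ v) : E.push t = F.cls := by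
  have := ShortComplex.ShortExact.extClass_naturality E.shortExact F.shortExact
    { τ₁ := t, τ₂ := v, τ₃ := 𝟙 Y, comm₁₂ := ht, comm₂₃ := by simp [hv] }
  rw [push, cls, cls]
  rw [Ext.mk₀_id_comp] at this
  exact this

/-- If the pushout of `E` along `t` has the class of `F`, then `t` extends to a morphism of
extensions over `Y`. -/
lemma exists_factor {K₁ K₂ Y : A} (E : SES K₁ Y) (F : SES K₂ Y) (t : K₁ ⟶ K₂)
    (h : E.push t = F.cls) : ∃ v : E.X ⟶ F.X, v ≫ F.p = E.p ∧ t ≫ F.i = E.i ≫ v := by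
  have := E.shortExact.epi_g
  have hz : E.shortExact.extClass.comp (Ext.mk₀ (t ≫ F.i)) (add_zero 1) = 0 := by
    change E.push (t ≫ F.i) = 0
    rw [push_comp, h]
    exact F.shortExact.extClass_comp
  obtain ⟨v', hv'⟩ := Ext.contravariant_sequence_exact₁ E.shortExact F.X _ (add_zero 1) hz
  obtain ⟨v, rfl⟩ := (Ext.mk₀_bijective _ _).2 v'
  rw [Ext.mk₀_comp_mk₀] at hv'
  replace hv' : E.i ≫ v = t ≫ F.i := (Ext.mk₀_bijective _ _).1 hv'
  let y : Y ⟶ Y := E.shortExact.exact.desc (v ≫ F.p) (by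
    change E.i ≫ v ≫ F.p = 0
    rw [reassoc_of% hv', F.zero, comp_zero])
  have hy : E.p ≫ y = v ≫ F.p := E.shortExact.exact.g_desc _ _
  have hn : E.push t = (Ext.mk₀ y).comp F.cls (zero_add 1) :=
    ShortComplex.ShortExact.extClass_naturality E.shortExact F.shortExact
      { τ₁ := t, τ₂ := v, τ₃ := y, comm₁₂ := hv'.symm, comm₂₃ := hy.symm }
  have hy0 : (Ext.mk₀ (y - 𝟙 Y)).comp F.shortExact.extClass (zero_add 1) = 0 := by
    rw [sub_eq_add_neg, Ext.mk₀_add, Ext.mk₀_neg, Ext.add_comp, Ext.neg_comp, Ext.mk₀_id_comp]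
    change (Ext.mk₀ y).comp F.cls (zero_add 1) + -F.cls = 0
    rw [← hn, h, add_neg_cancel]
  obtain ⟨z', hz'⟩ := Ext.covariant_sequence_exact₃ _ F.shortExact _ (zero_add 1) hy0
  obtain ⟨z, rfl⟩ := (Ext.mk₀_bijective _ _).2 z'
  rw [Ext.mk₀_comp_mk₀] at hz'
  replace hz' : z ≫ F.p = y - 𝟙 Y := (Ext.mk₀_bijective _ _).1 hz'
  refine ⟨v - E.p ≫ z, ?_, ?_⟩
  · rw [Preadditive.sub_comp, Category.assoc, hz', Preadditive.comp_sub, hy]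
    simp
  · rw [Preadditive.comp_sub, hv', ← Category.assoc, E.zero]
    simp

lemma isIso_iff {K₁ K₂ Y : A} (E : SES K₁ Y) (F : SES K₂ Y) (v : E.X ⟶ F.X)
    (hv : v ≫ F.p = E.p) (t : K₁ ⟶ K₂) (ht : t ≫ F.i = E.i ≫ v) : IsIso v ↔ IsIso t := by
  have : Mono F.i := F.shortExact.mono_f
  have : Mono E.i := E.shortExact.mono_f
  constructor
  · intro _
    obtain ⟨s, hs⟩ := F.exists_kernel_map E (inv v) (by rw [IsIso.inv_comp_eq, hv])
    refine ⟨s, ?_, ?_⟩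
    · rw [← cancel_mono E.i, Category.assoc, hs, reassoc_of% ht]
      simp
    · rw [← cancel_mono F.i, Category.assoc, ht, reassoc_of% hs]
      simp
  · intro _
    let φ : ShortComplex.mk E.i E.p E.zero ⟶ ShortComplex.mk F.i F.p F.zero :=
      { τ₁ := t, τ₂ := v, τ₃ := 𝟙 Y, comm₁₂ := ht, comm₂₃ := by simp [hv] }
    have : IsIso φ.τ₁ := ‹IsIso t›
    have : IsIso φ.τ₃ := inferInstanceAs (IsIso (𝟙 Y))
    exact ShortComplex.isIso₂_of_shortExact_of_isIso₁₃ φ E.shortExact F.shortExact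

lemma rightMinimal_iff {K K₁ Y : A} (E : SES K₁ Y) (h : InAdd K K₁) :
    RightMinimal E.p ↔ ModRightMinimal (E.conn K) := by
  constructor
  · intro hE g hg
    obtain ⟨t, ht⟩ := h.exists_precomp g
    have hcls : E.push t = E.cls := h.ext_ext fun w => by
      rw [← push_comp, ← ht]
      exact LinearMap.congr_fun hg w
    obtain ⟨v, hv, hvt⟩ := E.exists_factor E t hcls
    have : IsIso t := (E.isIso_iff E v hv t hvt).1 (hE v hv)
    have hg' : g = precompEnd K t := LinearMap.ext ht
    rw [hg']
    exact ⟨fun a b hab => (cancel_epi t).1 hab, fun b => ⟨inv t ≫ b, by simp⟩⟩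
  · intro hc v hv
    obtain ⟨t, ht⟩ := E.exists_kernel_map E v hv
    refine (E.isIso_iff E v hv t ht).2 (h.isIso_of_bijective_precompEnd h t (hc _ ?_))
    ext w
    exact push_comp_of_push_eq (E.push_eq_cls E v hv t ht) w

lemma range_conn_le {K₁ K₂ Y : A} {E : SES K₁ Y} {F : SES K₂ Y} (h : Factors E.p F.p) (K : A) :
    LinearMap.range (F.conn K) ≤ LinearMap.range (E.conn K) := by
  obtain ⟨v, hv⟩ := h
  obtain ⟨t, ht⟩ := E.exists_kernel_map F v hv
  rintro _ ⟨w, rfl⟩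
  exact ⟨t ≫ w, push_comp_of_push_eq (E.push_eq_cls F v hv t ht) w⟩

/-- The extension defined by an epimorphism. -/
noncomputable def ofEpi {X Y : A} (α : X ⟶ Y) [Epi α] : SES (kernel α) Y where
  X := X
  i := kernel.ι α
  p := α
  zero := kernel.condition α
  shortExact :=
    { exact := ShortComplex.exact_of_f_is_kernel _ (kernelIsKernel α)
      mono_f := inferInstanceAs (Mono (kernel.ι α))
      epi_g := inferInstanceAs (Epi α) }

/-- Every extension has a pushout along any morphism out of its kernel. -/
lemma exists_pushout {K₁ K₂ Y : A} (E : SES K₁ Y) (q : K₁ ⟶ K₂) :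
    ∃ F : SES K₂ Y, E.push q = F.cls := by
  have : Mono E.i := E.shortExact.mono_f
  have : Epi E.p := E.shortExact.epi_g
  let p' : pushout E.i q ⟶ Y := pushout.desc E.p 0 (by rw [E.zero, comp_zero])
  have hp : pushout.inl E.i q ≫ p' = E.p := pushout.inl_desc _ _ _
  have hz : pushout.inr E.i q ≫ p' = 0 := pushout.inr_desc _ _ _
  have hepi : Epi p' := epi_of_epi_fac hp
  have hcok : IsColimit (CokernelCofork.ofπ p' hz) :=
    CokernelCofork.IsColimit.ofπ' p' hz fun {Z} k hk =>
      ⟨E.shortExact.exact.desc (pushout.inl E.i q ≫ k) (by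
        change E.i ≫ pushout.inl E.i q ≫ k = 0
        rw [pushout.condition_assoc, hk, comp_zero]), by
        apply pushout.hom_ext
        · rw [reassoc_of% hp]
          exact E.shortExact.exact.g_desc _ _
        · rw [reassoc_of% hz, zero_comp]
          exact hk.symm⟩
  let F : SES K₂ Y :=
    { X := pushout E.i q
      i := pushout.inr E.i q
      p := p'
      zero := hz
      shortExact :=
        { exact := ShortComplex.exact_of_g_is_cokernel _ hcok
          mono_f := inferInstanceAs (Mono (pushout.inr E.i q))
          epi_g := hepi } }
  exact ⟨F, E.push_eq_cls F (pushout.inl E.i q) hp q pushout.condition.symm⟩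

lemma exists_modRightMinimal {K K₁ Y : A} (E : SES K₁ Y) (h : InAdd K K₁) {X' : A} (α' : X' ⟶ Y)
    (hmin : RightMinimal α') (heq : RightEquiv E.p α') :
    ∃ (K₂ : A) (F : SES K₂ Y), InAdd K K₂ ∧ ModRightMinimal (F.conn K) ∧
      LinearMap.range (F.conn K) = LinearMap.range (E.conn K) := by
  have : Epi E.p := E.shortExact.epi_g
  have : Epi α' := epi_of_epi_fac heq.1.choose_spec
  let F := ofEpi α'
  obtain ⟨v, hv⟩ : ∃ v : E.X ⟶ F.X, v ≫ F.p = E.p := heq.1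
  obtain ⟨u, hu⟩ : ∃ u : F.X ⟶ E.X, u ≫ E.p = F.p := heq.2
  obtain ⟨b, hb⟩ := E.exists_kernel_map F v hv
  obtain ⟨a, ha⟩ := F.exists_kernel_map E u hu
  have huv : (u ≫ v) ≫ F.p = F.p := by
    rw [Category.assoc, hv, hu]
  have : IsIso (a ≫ b) := (F.isIso_iff F (u ≫ v) huv (a ≫ b)
    (by rw [Category.assoc, hb, reassoc_of% ha])).1 (hmin _ huv)
  have hF : InAdd K (kernel α') := h.of_retract a (b ≫ inv (a ≫ b))
    (by rw [← Category.assoc, IsIso.hom_inv_id])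
  exact ⟨_, F, hF, (F.rightMinimal_iff hF).1 hmin,
    le_antisymm (range_conn_le heq.1 K) (range_conn_le heq.2 K)⟩

lemma exists_split_of_idempotent {K K₁ Y : A} (E : SES K₁ Y) (h : InAdd K K₁) (t : K₁ ⟶ K₁)
    (ht : t ≫ t = t) (hcls : E.push t = E.cls) :
    ∃ (K₂ : A) (F : SES K₂ Y) (q : K₁ ⟶ K₂) (j : K₂ ⟶ K₁), InAdd K K₂ ∧ q ≫ j = t ∧
      j ≫ q = 𝟙 K₂ ∧ E.push q = F.cls ∧ RightEquiv E.p F.p := by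
  obtain ⟨K₂, j, q, hjq, hqj⟩ := IsIdempotentComplete.idempotents_split K₁ t ht
  obtain ⟨F, hF⟩ := E.exists_pushout q
  refine ⟨K₂, F, q, j, h.of_retract j q hjq, hqj, hjq, hF, ?_, ?_⟩
  · obtain ⟨v, hv, -⟩ := E.exists_factor F q hF
    exact ⟨v, hv⟩
  · obtain ⟨v, hv, -⟩ := F.exists_factor E j (by rw [← push_comp_of_push_eq hF, hqj, hcls])
    exact ⟨v, hv⟩

end SES

lemma ModRightMinimal.of_equiv {R : Type*} [Ring R] {M M' N N' : Type*} [AddCommGroup M]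
    [AddCommGroup M'] [AddCommGroup N] [AddCommGroup N'] [Module R M] [Module R M'] [Module R N]
    [Module R N'] {c : M →ₗ[R] N} (hc : ModRightMinimal c) (e : M' ≃ₗ[R] M) (ι : N' →ₗ[R] N)
    {c' : M' →ₗ[R] N'} (h : ι.comp c' = c.comp e.toLinearMap) : ModRightMinimal c' := by
  intro g hg
  have := hc (e.toLinearMap.comp (g.comp e.symm.toLinearMap)) (by
    ext m
    have h₁ := LinearMap.congr_fun h (g (e.symm m))
    have h₂ := LinearMap.congr_fun h (e.symm m)
    have h₃ := LinearMap.congr_fun hg (e.symm m)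
    simp only [LinearMap.comp_apply, LinearEquiv.coe_coe, LinearEquiv.apply_symm_apply]
      at h₁ h₂ h₃ ⊢
    rw [← h₁, h₃, h₂])
  have hg' : (g : M' → M') =
      e.symm ∘ (e.toLinearMap.comp (g.comp e.symm.toLinearMap)) ∘ e := by
    ext m; simp
  rw [hg']
  exact e.symm.bijective.comp (this.comp e.bijective)

/-- A projective cover of the image of `c : M → N`, with `M` projective, is a direct summand of
`M` through which `c` factors. -/
lemma HasProjCover.exists_retract {R : Type*} [Ring R] {M : Type*} {N : Type w'}
    [AddCommGroup M] [AddCommGroup N] [Module R M] [Module R N] [Module.Projective R M]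
    {c : M →ₗ[R] N} (h : HasProjCover R (LinearMap.range c)) :
    ∃ (P : Type w') (_ : AddCommGroup P) (_ : Module R P) (f : P →ₗ[R] N) (g : M →ₗ[R] P)
      (s : P →ₗ[R] M), g.comp s = LinearMap.id ∧ f.comp g = c ∧ c.comp s = f ∧
        ModRightMinimal f := by
  obtain ⟨P, _, _, f, _, hf, hmin⟩ := h
  obtain ⟨g, hg⟩ := Module.projective_lifting_property f c.rangeRestrict hf
  obtain ⟨s, hs⟩ := Module.projective_lifting_property c.rangeRestrict f
    c.surjective_rangeRestrict
  have ha : f.comp (g.comp s) = f := by rw [← LinearMap.comp_assoc, hg, hs]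
  let a := LinearEquiv.ofBijective (g.comp s) (hmin _ ha)
  have ha' : f.comp a.symm.toLinearMap = f := by
    ext p
    have := LinearMap.congr_fun ha (a.symm p)
    have h₂ : (g.comp s) (a.symm p) = p := a.apply_symm_apply p
    rw [LinearMap.comp_apply, h₂] at this
    simp [this]
  have hf' : c.comp (s.comp a.symm.toLinearMap) = (Submodule.subtype _).comp f := by
    rw [← LinearMap.comp_assoc]
    conv_rhs => rw [← ha', ← hs]
    rfl
  refine ⟨P, _, _, (Submodule.subtype _).comp f, g, s.comp a.symm.toLinearMap, ?_, ?_, hf', ?_⟩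
  · ext p
    exact a.apply_symm_apply p
  · rw [LinearMap.comp_assoc, hg]
    rfl
  · intro φ hφ
    refine hmin φ (LinearMap.ext fun p => Subtype.ext ?_)
    exact LinearMap.congr_fun hφ p

/-- an epimorphism `α` with kernel in `add K` is right equivalent to a
right minimal morphism iff the `Γ(K)`-module `Im c(ξ_α, K)` admits a projective cover. -/
theorem stmt10 {K K₁ Y : A} (E : SES K₁ Y) (h : InAdd K K₁) :
    (∃ (X' : A) (α' : X' ⟶ Y), RightMinimal α' ∧ RightEquiv E.p α') ↔
      HasProjCover (End K) (LinearMap.range (E.conn K)) := by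
  constructor
  · rintro ⟨X', α', hmin, heq⟩
    obtain ⟨K₂, F, hK₂, hF, hrange⟩ := E.exists_modRightMinimal h α' hmin heq
    rw [← hrange]
    have : Small.{w} (K₂ ⟶ K) := ⟨_, ⟨Ext.homEquiv₀.symm⟩⟩
    have := hK₂.projective_hom
    let e := Shrink.linearEquiv.{w} (End K) (K₂ ⟶ K)
    refine ⟨Shrink.{w} (K₂ ⟶ K), inferInstance, inferInstance,
      (F.conn K).rangeRestrict.comp e.toLinearMap, Module.Projective.of_equiv e.symm,
      (F.conn K).surjective_rangeRestrict.comp e.surjective,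
      hF.of_equiv e (Submodule.subtype _) rfl⟩
  · intro hcov
    have := h.projective_hom
    obtain ⟨P, _, _, f, g, s, hgs, hfg, hcs, hmin⟩ := hcov.exists_retract
    obtain ⟨t, ht⟩ := h.exists_precomp (s.comp g)
    have hgs' : ∀ p, g (s p) = p := LinearMap.congr_fun hgs
    have htt : t ≫ t = t := h.hom_ext fun w => by
      rw [Category.assoc, ← ht, ← ht]
      simp [hgs']
    have hcls : E.push t = E.cls := h.ext_ext fun w => by
      rw [← SES.push_comp, ← ht]
      change E.conn K (s (g w)) = E.conn K w
      rw [← LinearMap.comp_apply, hcs, ← LinearMap.comp_apply, hfg]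
    obtain ⟨K₂, F, q, j, hK₂, hqj, hjq, hF, heq⟩ := E.exists_split_of_idempotent h t htt hcls
    have htq : ∀ w : K₂ ⟶ K, s (g (q ≫ w)) = q ≫ w := fun w => by
      rw [← LinearMap.comp_apply, ht, ← hqj, Category.assoc, reassoc_of% hjq]
    let G : (K₂ ⟶ K) ≃ₗ[End K] P := LinearEquiv.ofLinearMap (g.comp (precompEnd K q)) ((precompEnd K j).comp s)
      (by
        ext p
        change g (q ≫ j ≫ s p) = p
        rw [← Category.assoc, hqj, ← ht, LinearMap.comp_apply, hgs', hgs'])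
      (by
        ext w
        change j ≫ s (g (q ≫ w)) = w
        rw [htq, reassoc_of% hjq])
    refine ⟨F.X, F.p, (F.rightMinimal_iff hK₂).2 (hmin.of_equiv G LinearMap.id ?_), heq⟩
    ext w
    change F.push w = f (g (q ≫ w))
    rw [← LinearMap.comp_apply, hfg]
    exact (SES.push_comp_of_push_eq hF w).symm
end

section
/- Let A be an abelian category and K, Y objects. The map δ_{K,Y} sending the right equivalence class [α⟩ of an epimorphism α : X → Y with kernel in add K to the Γ(K)-submodule Im c(ξ_α, K) of Ext¹(Y, K) is an order-reversing bijection between the poset _K[→ Y⟩_epi of such right equivalence classes and the poset of finitely generated Γ(K)-submodules of Ext¹(Y, K) ordered by inclusion. -/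
set_option linter.unusedSectionVars false

open CategoryTheory Abelian Limits

universe w v u

attribute [local instance] CategoryTheory.Abelian.hasFiniteBiproducts

variable {A : Type u} [Category.{v} A] [Abelian A]

variable [HasExt.{w} A]

universe w'

/-- The component in degree `0` of a quasi-isomorphism to a single complex is an epimorphism on
cycles. -/
lemma epi_iCycles_comp_f_of_quasiIso {L : CochainComplex A ℤ} {Y : A}
    (s : L ⟶ (HomologicalComplex.single A (ComplexShape.up ℤ) 0).obj Y) [QuasiIso s] :
    Epi (L.iCycles 0 ≫ s.f 0) := by
  have := ((HomologicalComplex.single A (ComplexShape.up ℤ) 0).obj Y).isIso_iCycles 0 _ rfl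
    (by simp)
  have := ((HomologicalComplex.single A (ComplexShape.up ℤ) 0).obj Y).isIso_homologyπ _ 0 rfl
    (by simp)
  have h : HomologicalComplex.cyclesMap s 0 =
      (L.homologyπ 0 ≫ HomologicalComplex.homologyMap s 0) ≫
        inv (((HomologicalComplex.single A (ComplexShape.up ℤ) 0).obj Y).homologyπ 0) := by
    simp
  have : Epi (HomologicalComplex.cyclesMap s 0) := by
    rw [h]; infer_instance
  rw [← HomologicalComplex.cyclesMap_i]
  infer_instance

/-- Classes in `Ext¹` are effaceable by an epimorphism. -/
lemma exists_epi_mk₀_comp_eq_zero {Y K : A} (e : Ext Y K 1) :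
    ∃ (X : A) (p : X ⟶ Y), Epi p ∧ (Ext.mk₀ p).comp e (zero_add 1) = 0 := by
  let := HasDerivedCategory.standard A
  let S := HomologicalComplex.single A (ComplexShape.up ℤ) 0
  let c : (DerivedCategory.singleFunctor A 0).obj K⟦((1 : ℕ) : ℤ)⟧ ≅
      DerivedCategory.Q.obj ((S.obj K)⟦(1 : ℤ)⟧) :=
    ((DerivedCategory.Q.commShiftIso (1 : ℤ)).app (S.obj K)).symm
  obtain ⟨L, s, hs, g, hg⟩ := DerivedCategory.right_fac (X := S.obj Y) (e.hom ≫ c.hom)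
  have : QuasiIso s := (DerivedCategory.isIso_Q_map_iff_quasiIso A s).1 hs
  let σ : S.obj (L.cycles 0) ⟶ L :=
    HomologicalComplex.mkHomFromSingle (L.iCycles 0) (fun _ _ ↦ L.iCycles_d _ _)
  let p : L.cycles 0 ⟶ Y :=
    (L.iCycles 0 ≫ s.f 0) ≫ (HomologicalComplex.singleObjXSelf (ComplexShape.up ℤ) 0 Y).hom
  have hp : S.map p = σ ≫ s := by
    apply HomologicalComplex.from_single_hom_ext
    simp [S, σ, p, HomologicalComplex.single_map_f_self]
  have hσ : σ ≫ g = 0 := by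
    apply HomologicalComplex.from_single_hom_ext
    exact (HomologicalComplex.isZero_single_obj_X (ComplexShape.up ℤ) 0 K (0 + 1)
      (by simp)).eq_of_tgt _ _
  refine ⟨_, p, ?_, ?_⟩
  · have := epi_iCycles_comp_f_of_quasiIso s
    infer_instance
  · apply Ext.ext
    rw [Ext.comp_hom, Ext.mk₀_hom, ShiftedHom.mk₀_comp, Ext.zero_hom, ← cancel_mono c.hom,
      Category.assoc, zero_comp]
    refine (congrArg (DerivedCategory.Q.map (S.map p) ≫ ·) hg).trans ?_
    rw [hp, Functor.map_comp, Category.assoc, IsIso.hom_inv_id_assoc, ← Functor.map_comp, hσ,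
      Functor.map_zero]
    rfl

/-- The pushout of a short exact sequence along a morphism out of its kernel. -/
noncomputable def SES.pushoutSES {K₁ Z Y : A} (E : SES K₁ Y) (f : K₁ ⟶ Z) : SES Z Y where
  X := pushout f E.i
  i := pushout.inl f E.i
  p := pushout.desc 0 E.p (by rw [comp_zero, E.zero])
  zero := pushout.inl_desc _ _ _
  shortExact := by
    have := E.shortExact.mono_f
    have := E.shortExact.epi_g
    dsimp at *
    have : Epi (pushout.desc 0 E.p (by rw [comp_zero, E.zero]) : pushout f E.i ⟶ Y) := by
      apply epi_of_epi_fac (pushout.inr_desc (f := f) (g := E.i) 0 E.p _)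
    refine { exact := ?_, mono_f := by dsimp; infer_instance, epi_g := this }
    apply ShortComplex.exact_of_g_is_cokernel
    refine CokernelCofork.IsColimit.ofπ' _ _ fun {W} k hk ↦ ?_
    have hk' : E.i ≫ pushout.inr f E.i ≫ k = 0 := by
      dsimp at hk
      rw [← pushout.condition_assoc, hk, comp_zero]
    refine ⟨E.shortExact.exact.desc (pushout.inr f E.i ≫ k) hk', ?_⟩
    apply pushout.hom_ext
    · dsimp at hk ⊢
      exact (pushout.inl_desc_assoc _ _ _ _).trans (zero_comp.trans hk.symm)
    · dsimp
      rw [pushout.inr_desc_assoc]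
      exact E.shortExact.exact.g_desc _ _

lemma SES.cls_pushoutSES {K₁ Z Y : A} (E : SES K₁ Y) (f : K₁ ⟶ Z) :
    (E.pushoutSES f).cls = E.push f := by
  let φ : ShortComplex.mk E.i E.p E.zero ⟶
      ShortComplex.mk (E.pushoutSES f).i (E.pushoutSES f).p (E.pushoutSES f).zero :=
    { τ₁ := f
      τ₂ := pushout.inr f E.i
      τ₃ := 𝟙 Y
      comm₁₂ := pushout.condition
      comm₂₃ := (pushout.inr_desc _ _ _).trans (Category.comp_id _).symm }
  have h := ShortComplex.ShortExact.extClass_naturality E.shortExact (E.pushoutSES f).shortExact φ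
  exact (h.trans (Ext.mk₀_id_comp _)).symm

/-- Every class in `Ext¹` is the class of a short exact sequence. -/
lemma SES.exists_cls_eq {Y K : A} (e : Ext Y K 1) : ∃ E : SES K Y, E.cls = e := by
  obtain ⟨X, p, hp, h⟩ := exists_epi_mk₀_comp_eq_zero e
  let E : SES (kernel p) Y :=
    { X := X
      i := kernel.ι p
      p := p
      zero := kernel.condition p
      shortExact :=
        { exact := ShortComplex.exact_of_f_is_kernel _ (kernelIsKernel p) } }
  obtain ⟨x, hx⟩ := Ext.contravariant_sequence_exact₃ E.shortExact K e h (add_zero 1)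
  obtain ⟨f, rfl⟩ := (Ext.mk₀_bijective _ _).2 x
  exact ⟨E.pushoutSES f, (E.cls_pushoutSES f).trans hx⟩

lemma SES.push_comp_s14 {K₁ Y Z W : A} (E : SES K₁ Y) (u : K₁ ⟶ Z) (v : Z ⟶ W) :
    E.push (u ≫ v) = (E.push u).comp (Ext.mk₀ v) (add_zero 1) := by
  rw [SES.push, SES.push, Ext.comp_assoc_of_third_deg_zero, Ext.mk₀_comp_mk₀]

lemma SES.mk₀_p_comp_cls {K₁ Y : A} (E : SES K₁ Y) :
    (Ext.mk₀ E.p).comp E.cls (zero_add 1) = 0 :=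
  E.shortExact.comp_extClass

lemma SES.factors_iff {K₁ K₂ Y : A} (E₁ : SES K₁ Y) (E₂ : SES K₂ Y) :
    Factors E₁.p E₂.p ↔ ∃ t : K₁ ⟶ K₂, E₁.push t = E₂.cls := by
  constructor
  · rintro ⟨v, hv⟩
    have h : (Ext.mk₀ E₁.p).comp E₂.cls (zero_add 1) = 0 := by
      rw [← hv, ← Ext.mk₀_comp_mk₀_assoc, E₂.mk₀_p_comp_cls, Ext.comp_zero]
    obtain ⟨x, hx⟩ := Ext.contravariant_sequence_exact₃ E₁.shortExact K₂ E₂.cls h (add_zero 1)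
    obtain ⟨t, rfl⟩ := (Ext.mk₀_bijective _ _).2 x
    exact ⟨t, hx⟩
  · rintro ⟨t, ht⟩
    have h : (Ext.mk₀ E₁.p).comp E₂.cls (zero_add 1) = 0 := by
      rw [← ht, SES.push, ← Ext.comp_assoc_of_third_deg_zero, E₁.mk₀_p_comp_cls, Ext.zero_comp]
    obtain ⟨x, hx⟩ := Ext.covariant_sequence_exact₃ E₁.X E₂.shortExact (Ext.mk₀ E₁.p)
      (zero_add 1) h
    obtain ⟨v, rfl⟩ := (Ext.mk₀_bijective _ _).2 x
    refine ⟨v, (Ext.mk₀_bijective _ _).1 ?_⟩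
    rw [← Ext.mk₀_comp_mk₀]
    exact hx

lemma eq_of_comp_mk₀_biproduct_π_eq {Y K : A} {n : ℕ} {m : ℕ} {e e' : Ext Y (⨁ fun _ : Fin n => K) m}
    (h : ∀ i, e.comp (Ext.mk₀ (biproduct.π (fun _ : Fin n => K) i)) (add_zero m) =
      e'.comp (Ext.mk₀ (biproduct.π (fun _ : Fin n => K) i)) (add_zero m)) : e = e' :=
  (Ext.addEquivBiproduct Y (biproduct.isBilimit fun _ : Fin n => K) m).injective (funext h)

lemma SES.factors_iff_range_le {K K₁ K₂ Y : A} (E₁ : SES K₁ Y) (E₂ : SES K₂ Y)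
    (h₂ : InAdd K K₂) :
    Factors E₁.p E₂.p ↔ LinearMap.range (E₂.conn K) ≤ LinearMap.range (E₁.conn K) := by
  rw [SES.factors_iff]
  constructor
  · rintro ⟨t, ht⟩ _ ⟨u, rfl⟩
    refine ⟨t ≫ u, ?_⟩
    change E₁.push (t ≫ u) = E₂.push u
    rw [SES.push_comp_s14, ht, SES.push]
  · intro h
    obtain ⟨n, s, r, hsr⟩ := h₂
    choose t ht using fun i : Fin n ↦
      h ⟨s ≫ biproduct.π (fun _ : Fin n => K) i, rfl⟩
    have key : E₁.push (biproduct.lift t) = E₂.push s := by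
      apply eq_of_comp_mk₀_biproduct_π_eq
      intro i
      rw [← SES.push_comp_s14, ← SES.push_comp_s14, biproduct.lift_π]
      exact ht i
    refine ⟨biproduct.lift t ≫ r, ?_⟩
    rw [SES.push_comp_s14, key, ← SES.push_comp_s14, hsr, SES.push, Ext.comp_mk₀_id]

/-- If `s : K₁ ⟶ Kⁿ` is a split monomorphism, then the components of `s` span the image of the
connecting map. -/
lemma SES.range_conn_eq_span {K K₁ Y : A} (E : SES K₁ Y) {n : ℕ}
    (s : K₁ ⟶ ⨁ fun _ : Fin n => K) (r : (⨁ fun _ : Fin n => K) ⟶ K₁) (hsr : s ≫ r = 𝟙 K₁) :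
    LinearMap.range (E.conn K) = Submodule.span (End K)
      (Set.range fun i ↦ E.push (s ≫ biproduct.π (fun _ : Fin n => K) i)) := by
  apply le_antisymm
  · rintro _ ⟨u, rfl⟩
    have hu : u = ∑ i, (show End K from biproduct.ι (fun _ : Fin n => K) i ≫ r ≫ u) •
        (s ≫ biproduct.π (fun _ : Fin n => K) i) := by
      simp only [End.smul_right, Category.assoc]
      calc u = s ≫ (∑ i, biproduct.π (fun _ : Fin n => K) i ≫
              biproduct.ι (fun _ : Fin n => K) i) ≫ r ≫ u := by
            rw [biproduct.total, Category.id_comp, ← Category.assoc s r u, hsr, Category.id_comp]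
        _ = _ := by simp only [Preadditive.sum_comp, Preadditive.comp_sum, Category.assoc]
    rw [hu, map_sum]
    refine Submodule.sum_mem _ fun i _ ↦ ?_
    rw [map_smul]
    exact Submodule.smul_mem _ _ (Submodule.subset_span ⟨i, rfl⟩)
  · rw [Submodule.span_le]
    rintro _ ⟨i, rfl⟩
    exact ⟨_, rfl⟩

lemma SES.fg_range_conn {K K₁ Y : A} (E : SES K₁ Y) (h : InAdd K K₁) :
    (LinearMap.range (E.conn K)).FG := by
  obtain ⟨n, s, r, hsr⟩ := h
  rw [E.range_conn_eq_span s r hsr]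
  exact Submodule.fg_span (Set.finite_range _)

/-- Every finitely generated submodule of `Ext¹(Y, K)` is the image of a connecting map. -/
lemma SES.exists_range_conn_eq {K Y : A} (L : Submodule (End K) (Ext Y K 1)) (hL : L.FG) :
    ∃ (K₁ : A) (E : SES K₁ Y), InAdd K K₁ ∧ LinearMap.range (E.conn K) = L := by
  obtain ⟨n, v, rfl⟩ := Submodule.fg_iff_exists_fin_generating_family.1 hL
  let φ := Ext.addEquivBiproduct Y (biproduct.isBilimit fun _ : Fin n => K) 1
  obtain ⟨E, hE⟩ := SES.exists_cls_eq (φ.symm v)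
  refine ⟨_, E, ⟨n, 𝟙 _, 𝟙 _, Category.id_comp _⟩, ?_⟩
  rw [E.range_conn_eq_span (𝟙 _) (𝟙 _) (Category.id_comp _)]
  congr 2
  funext i
  rw [Category.id_comp, SES.push, hE]
  exact congrFun (φ.apply_symm_apply v) i

/-- `δ_{K,Y}` is an order-reversing bijection between the poset of right
equivalence classes of epimorphisms onto `Y` with kernel in `add K` and the poset of
finitely generated `Γ(K)`-submodules of `Ext¹(Y, K)`:
it is well defined and injective on right equivalence classes, order-reversing,
takes values in finitely generated submodules, and is surjective onto them. -/
theorem stmt14 (K Y : A) :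
    (∀ (K₁ K₂ : A) (E₁ : SES K₁ Y) (E₂ : SES K₂ Y), InAdd K K₁ → InAdd K K₂ →
      (RightEquiv E₁.p E₂.p ↔
        LinearMap.range (E₁.conn K) = LinearMap.range (E₂.conn K))) ∧
    (∀ (K₁ K₂ : A) (E₁ : SES K₁ Y) (E₂ : SES K₂ Y), InAdd K K₁ → InAdd K K₂ →
      (Factors E₁.p E₂.p ↔
        LinearMap.range (E₂.conn K) ≤ LinearMap.range (E₁.conn K))) ∧
    (∀ (K₁ : A) (E : SES K₁ Y), InAdd K K₁ → (LinearMap.range (E.conn K)).FG) ∧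
    (∀ L : Submodule (End K) (Ext Y K 1), L.FG →
      ∃ (K₁ : A) (E : SES K₁ Y), InAdd K K₁ ∧ LinearMap.range (E.conn K) = L) := by
  refine ⟨fun K₁ K₂ E₁ E₂ h₁ h₂ ↦ ?_, fun K₁ K₂ E₁ E₂ _ h₂ ↦ E₁.factors_iff_range_le E₂ h₂,
    fun K₁ E h ↦ E.fg_range_conn h, SES.exists_range_conn_eq⟩
  rw [RightEquiv, E₁.factors_iff_range_le E₂ h₂, E₂.factors_iff_range_le E₁ h₁, and_comm,
    le_antisymm_iff]
end
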